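/- If T is a tree on an even number n of vertices that is not a path, then T(T) ≤ 1 < (n+2)/n = T(P_n); hence among all trees on an even number of vertices, the path P_n is the unique tree attaining the maximum tenacity. -/

import Mathlib

open SimpleGraph

/-- Number of connected components `ω(G)`. -/
noncomputable def SimpleGraph.omegaComp {W : Type*} (G : SimpleGraph W) : ℕ :=
  Nat.card G.ConnectedComponent

/-- Order `τ(G)` of a largest connected component of `G`. -/
noncomputable def SimpleGraph.tauMax {W : Type*} (G : SimpleGraph W) : ℕ :=
  sSup (Set.range fun c : G.ConnectedComponent =>
    Nat.card {v : W // G.connectedComponentMk v = c})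

/-- The graph `G - X` obtained by deleting the vertices of `X`. -/
def SimpleGraph.delVerts {V : Type*} (G : SimpleGraph V) (X : Finset V) :
    SimpleGraph {v : V // v ∉ X} :=
  SimpleGraph.comap Subtype.val G

/-- `X` is a vertex cut of `G`: deleting `X` leaves more than one component. -/
def SimpleGraph.IsVertexCut {V : Type*} (G : SimpleGraph V) (X : Finset V) : Prop :=
  1 < (G.delVerts X).omegaComp

/-- The tenacity `T(G) = min over vertex cuts X of (|X| + τ(G−X)) / ω(G−X)`. -/
noncomputable def SimpleGraph.tenacity {V : Type*} [Fintype V] (G : SimpleGraph V) : ℝ :=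
  sInf { t : ℝ | ∃ X : Finset V, G.IsVertexCut X ∧
    t = ((X.card : ℝ) + (G.delVerts X).tauMax) / (G.delVerts X).omegaComp }

/-- Vertex degree via `Nat.card` (no decidability assumptions needed). -/
noncomputable def SimpleGraph.deg {V : Type*} (G : SimpleGraph V) (v : V) : ℕ :=
  Nat.card (G.neighborSet v)

/-- A unicyclic graph: connected with as many edges as vertices. -/
def SimpleGraph.Unicyclic {V : Type*} [Fintype V] (G : SimpleGraph V) : Prop :=
  G.Connected ∧ Nat.card G.edgeSet = Fintype.card V

namespace SimpleGraph

section Components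

variable {W : Type*} [Finite W] (G : SimpleGraph W)

theorem card_le_card_edgeSet_add_omegaComp :
    Nat.card W ≤ Nat.card G.edgeSet + G.omegaComp := by
  classical
  cases isEmpty_or_nonempty W with
  | inl h => simp
  | inr h =>
  obtain ⟨r⟩ := h
  have := Fintype.ofFinite W
  have := Fintype.ofFinite G.ConnectedComponent
  let c₀ := G.connectedComponentMk r
  let star : Finset (Sym2 W) := (Finset.univ.erase c₀).image fun c => s(r, c.out)
  let H : SimpleGraph W := G ⊔ fromEdgeSet (star : Set (Sym2 W))
  have hreach : ∀ v, H.Reachable r v := by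
    intro v
    have hv : G.Reachable (G.connectedComponentMk v).out v :=
      ConnectedComponent.exact (Quot.out_eq _)
    refine Reachable.trans ?_ (hv.mono le_sup_left)
    by_cases hc : G.connectedComponentMk v = c₀
    · have : G.Reachable r (G.connectedComponentMk v).out :=
        (ConnectedComponent.exact hc.symm).trans hv.symm
      exact this.mono le_sup_left
    · by_cases hr : r = (G.connectedComponentMk v).out
      · rw [← hr]
      · refine Adj.reachable (Or.inr ?_)
        rw [fromEdgeSet_adj]
        refine ⟨?_, hr⟩
        simp only [star, Finset.coe_image, Set.mem_image, Finset.mem_coe, Finset.mem_erase]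
        exact ⟨_, ⟨hc, Finset.mem_univ _⟩, rfl⟩
  have hconn : H.Connected := (connected_iff_exists_forall_reachable H).2 ⟨r, hreach⟩
  have hcard := hconn.card_vert_le_card_edgeSet_add_one
  have hstar : star.card ≤ G.omegaComp - 1 := by
    refine Finset.card_image_le.trans ?_
    rw [Finset.card_erase_of_mem (Finset.mem_univ _), Finset.card_univ, omegaComp,
      Nat.card_eq_fintype_card]
  have hpos : 0 < G.omegaComp := by
    have : Nonempty G.ConnectedComponent := ⟨c₀⟩
    exact Nat.card_pos
  have hedge : Nat.card H.edgeSet ≤ Nat.card G.edgeSet + star.card := by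
    have hsub : H.edgeSet ⊆ G.edgeSet ∪ (star : Set (Sym2 W)) := by
      simp only [H, edgeSet_sup, edgeSet_fromEdgeSet]
      exact Set.union_subset_union_right _ Set.sdiff_subset
    calc Nat.card H.edgeSet = H.edgeSet.ncard := rfl
      _ ≤ (G.edgeSet ∪ (star : Set (Sym2 W))).ncard := Set.ncard_le_ncard hsub (Set.toFinite _)
      _ ≤ G.edgeSet.ncard + (star : Set (Sym2 W)).ncard := Set.ncard_union_le _ _
      _ = Nat.card G.edgeSet + star.card := by rw [Set.ncard_coe_finset]; rfl
  omega

theorem omegaComp_le_card : G.omegaComp ≤ Nat.card W :=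
  Nat.card_le_card_of_surjective G.connectedComponentMk Quot.mk_surjective

theorem card_component_le_tauMax (c : G.ConnectedComponent) :
    Nat.card {v : W // G.connectedComponentMk v = c} ≤ G.tauMax :=
  le_csSup (Set.finite_range _).bddAbove ⟨c, rfl⟩

theorem tauMax_pos [Nonempty W] : 0 < G.tauMax := by
  obtain ⟨v⟩ := ‹Nonempty W›
  have : Nonempty {u : W // G.connectedComponentMk u = G.connectedComponentMk v} := ⟨v, rfl⟩
  exact Nat.card_pos.trans_le (G.card_component_le_tauMax (G.connectedComponentMk v))

theorem card_le_omegaComp_mul_tauMax : Nat.card W ≤ G.omegaComp * G.tauMax := by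
  have := Fintype.ofFinite G.ConnectedComponent
  rw [← Nat.card_congr (Equiv.sigmaFiberEquiv G.connectedComponentMk), Nat.card_sigma]
  refine (Finset.sum_le_card_nsmul _ _ _ fun c _ => G.card_component_le_tauMax c).trans ?_
  rw [Finset.card_univ, omegaComp, Nat.card_eq_fintype_card, smul_eq_mul]

omit [Finite W] in
theorem tauMax_le_two (h : ∀ v a b, G.Adj v a → G.Adj v b → a = b) : G.tauMax ≤ 2 := by
  have hreach : ∀ u v, G.Reachable u v → u = v ∨ G.Adj u v := by
    rintro u v ⟨p⟩
    induction p with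
    | nil => exact Or.inl rfl
    | cons hadj q ih =>
      rcases ih with rfl | h'
      · exact Or.inr hadj
      · exact Or.inl (h _ _ _ hadj.symm h')
  refine csSup_le' ?_
  rintro _ ⟨c, rfl⟩
  change Set.ncard {v : W | G.connectedComponentMk v = c} ≤ 2
  by_contra! hlt
  obtain ⟨x, y, z, hx, hy, hz, hxy, hxz, hyz⟩ :=
    (Set.two_lt_ncard_iff (Set.finite_of_ncard_pos (by omega))).1 hlt
  have hxy' := hreach x y (ConnectedComponent.exact (hx.trans hy.symm))
  have hxz' := hreach x z (ConnectedComponent.exact (hx.trans hz.symm))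
  exact hyz (h x y z (hxy'.resolve_left hxy) (hxz'.resolve_left hxz))

omit [Finite W] in
theorem tauMax_bot_le_one : (⊥ : SimpleGraph W).tauMax ≤ 1 := by
  refine csSup_le' ?_
  rintro _ ⟨c, rfl⟩
  have : Subsingleton {v : W // (⊥ : SimpleGraph W).connectedComponentMk v = c} :=
    ⟨fun x y => Subtype.ext
      (reachable_bot.1 (ConnectedComponent.exact (x.2.trans y.2.symm)))⟩
  exact Finite.card_le_one_iff_subsingleton.2 this

omit [Finite W] in
theorem omegaComp_bot : (⊥ : SimpleGraph W).omegaComp = Nat.card W :=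
  (Nat.card_congr (Equiv.ofBijective (⊥ : SimpleGraph W).connectedComponentMk
    ⟨fun _ _ h => reachable_bot.1 (ConnectedComponent.exact h), Quot.mk_surjective⟩)).symm

end Components

section Tenacity

variable {V : Type*} [Fintype V] (G : SimpleGraph V)

theorem card_notMem (X : Finset V) : Nat.card {v : V // v ∉ X} + X.card = Fintype.card V := by
  classical
  rw [Nat.card_eq_fintype_card, Fintype.card_subtype_compl, Fintype.card_coe]
  exact Nat.sub_add_cancel X.card_le_univ

theorem tenacity_le {X : Finset V} (hX : G.IsVertexCut X) :
    G.tenacity ≤ ((X.card : ℝ) + (G.delVerts X).tauMax) / (G.delVerts X).omegaComp := by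
  refine csInf_le ⟨0, ?_⟩ ⟨X, hX, rfl⟩
  rintro _ ⟨Y, -, rfl⟩
  positivity

open Classical in
theorem card_edgeSet_delVerts_le (X : Finset V) :
    Nat.card (G.delVerts X).edgeSet ≤ {e ∈ G.edgeFinset | ¬ ∃ x ∈ X, x ∈ e}.card := by
  let f : (G.delVerts X).edgeSet → {e // e ∈ {e ∈ G.edgeFinset | ¬ ∃ x ∈ X, x ∈ e}} :=
    fun e => ⟨e.1.map Subtype.val, by
      obtain ⟨e, he⟩ := e
      induction e with
      | _ a b =>
      simp only [Finset.mem_filter, mem_edgeFinset, Sym2.map_mk, mem_edgeSet, Sym2.mem_iff]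
      refine ⟨he, ?_⟩
      rintro ⟨x, hx, rfl | rfl⟩
      · exact a.2 hx
      · exact b.2 hx⟩
  have hf : Function.Injective f := fun e₁ e₂ h =>
    Subtype.ext (Sym2.map.injective Subtype.val_injective (congrArg Subtype.val h))
  exact (Nat.card_le_card_of_injective f hf).trans_eq (Nat.card_eq_card_toFinset _ |>.trans
    (by rw [Finset.toFinset_coe]))

open Classical in
/-- Greedily deleting vertices of degree at least two, starting from a vertex of degree at least
three, leaves a graph of maximum degree at most one. -/
theorem exists_delVerts_matching {v a b c : V} (hab : a ≠ b) (hac : a ≠ c) (hbc : b ≠ c)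
    (ha : G.Adj v a) (hb : G.Adj v b) (hc : G.Adj v c) :
    ∃ X : Finset V, 2 * X.card + 1 ≤ {e ∈ G.edgeFinset | ∃ x ∈ X, x ∈ e}.card ∧
      ∀ v a b, (G.delVerts X).Adj v a → (G.delVerts X).Adj v b → a = b := by
  let S : Finset (Finset V) :=
    {X | 2 * X.card + 1 ≤ {e ∈ G.edgeFinset | ∃ x ∈ X, x ∈ e}.card}
  have hS : {v} ∈ S := by
    have hsub : ({s(v, a), s(v, b), s(v, c)} : Finset (Sym2 V)) ⊆
        {e ∈ G.edgeFinset | ∃ x ∈ ({v} : Finset V), x ∈ e} := by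
      intro e he
      simp only [Finset.mem_insert, Finset.mem_singleton] at he
      rcases he with rfl | rfl | rfl <;> simp [ha, hb, hc]
    have hcard : ({s(v, a), s(v, b), s(v, c)} : Finset (Sym2 V)).card = 3 := by
      rw [Finset.card_eq_three]
      exact ⟨_, _, _, by simp [hab, hb.ne], by simp [hac, hc.ne], by simp [hbc, hc.ne], rfl⟩
    have := Finset.card_le_card hsub
    simp only [S, Finset.mem_filter, Finset.mem_univ, true_and, Finset.card_singleton]
    omega
  obtain ⟨X, hX, hmax⟩ := S.exists_max_image Finset.card ⟨_, hS⟩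
  have hX' : 2 * X.card + 1 ≤ {e ∈ G.edgeFinset | ∃ x ∈ X, x ∈ e}.card := by simpa [S] using hX
  refine ⟨X, hX', ?_⟩
  rintro ⟨w, hw⟩ ⟨y, hy⟩ ⟨z, hz⟩ hwy hwz
  replace hwy : G.Adj w y := hwy
  replace hwz : G.Adj w z := hwz
  by_contra hyz
  replace hyz : y ≠ z := fun h => hyz (Subtype.ext h)
  have hins : insert w X ∈ S := by
    have hsub : {e ∈ G.edgeFinset | ∃ x ∈ X, x ∈ e} ∪ {s(w, y), s(w, z)} ⊆
        {e ∈ G.edgeFinset | ∃ x ∈ insert w X, x ∈ e} := by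
      intro e he
      simp only [Finset.mem_union, Finset.mem_filter, Finset.mem_insert,
        Finset.mem_singleton] at he ⊢
      rcases he with ⟨he, x, hx, hxe⟩ | rfl | rfl
      · exact ⟨he, x, Or.inr hx, hxe⟩
      · simp [hwy]
      · simp [hwz]
    have hdisj : Disjoint {e ∈ G.edgeFinset | ∃ x ∈ X, x ∈ e} {s(w, y), s(w, z)} := by
      rw [Finset.disjoint_left]
      intro e he he'
      simp only [Finset.mem_filter, Finset.mem_insert, Finset.mem_singleton] at he he'
      obtain ⟨-, x, hx, hxe⟩ := he
      rcases he' with rfl | rfl <;> rcases Sym2.mem_iff.1 hxe with rfl | rfl <;> contradiction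
    have hcard := Finset.card_le_card hsub
    rw [Finset.card_union_of_disjoint hdisj,
      Finset.card_pair (by simp [hyz, hwz.ne])] at hcard
    simp only [S, Finset.mem_filter, Finset.mem_univ, true_and, Finset.card_insert_of_notMem hw]
    omega
  have := hmax _ hins
  rw [Finset.card_insert_of_notMem hw] at this
  omega

variable {G} in
theorem IsTree.tenacity_le_one (hG : G.IsTree) {v a b c : V} (hab : a ≠ b) (hac : a ≠ c)
    (hbc : b ≠ c) (ha : G.Adj v a) (hb : G.Adj v b) (hc : G.Adj v c) : G.tenacity ≤ 1 := by
  classical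
  obtain ⟨X, hX, hdeg⟩ := G.exists_delVerts_matching hab hac hbc ha hb hc
  have hτ := (G.delVerts X).tauMax_le_two hdeg
  have hω : X.card + 2 ≤ (G.delVerts X).omegaComp := by
    have h₁ := (G.delVerts X).card_le_card_edgeSet_add_omegaComp
    have h₂ := G.card_edgeSet_delVerts_le X
    have h₃ := Finset.card_filter_add_card_filter_not (s := G.edgeFinset)
      (fun e => ∃ x ∈ X, x ∈ e)
    have h₄ := hG.card_edgeFinset
    have h₅ := card_notMem X
    omega
  refine (G.tenacity_le (X := X) (show 1 < _ by omega)).trans ?_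
  refine div_le_one_of_le₀ ?_ (Nat.cast_nonneg _)
  exact_mod_cast (by omega : X.card + (G.delVerts X).tauMax ≤ (G.delVerts X).omegaComp)

end Tenacity

section Path

/-- A tree is a path or has a vertex with three distinct neighbours. -/
theorem IsTree.nonempty_iso_pathGraph_or {V : Type*} [Fintype V] {G : SimpleGraph V}
    (hG : G.IsTree) : Nonempty (G ≃g pathGraph (Fintype.card V)) ∨
      ∃ v a b c : V, a ≠ b ∧ a ≠ c ∧ b ≠ c ∧ G.Adj v a ∧ G.Adj v b ∧ G.Adj v c := by
  classical
  rw [or_iff_not_imp_right]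
  intro hdeg
  have := hG.connected.nonempty
  obtain ⟨u, v, p, hp, hmax⟩ := Walk.exists_isPath_forall_isPath_length_le_length G
  have hclosed : ∀ x y, G.Adj x y → x ∈ p.support → y ∈ p.support := by
    intro x y hxy hx
    by_contra hy
    have hxu : x ≠ u := by
      rintro rfl
      have := hmax _ _ (Walk.cons hxy.symm p) (hp.cons hy)
      simp at this
    have hxv : x ≠ v := by
      rintro rfl
      have := hmax _ _ (p.concat hxy) (hp.concat hy hxy)
      simp at this
    obtain ⟨i, rfl, hi⟩ := Walk.mem_support_iff_exists_getVert.1 hx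
    have hi0 : i ≠ 0 := by rintro rfl; simp at hxu
    have hil : i ≠ p.length := by rintro rfl; simp at hxv
    obtain ⟨j, rfl⟩ := Nat.exists_eq_succ_of_ne_zero hi0
    refine hdeg ⟨p.getVert (j + 1), p.getVert j, p.getVert (j + 2), y, ?_, ?_, ?_,
      (p.adj_getVert_succ (by omega)).symm, p.adj_getVert_succ (by omega), hxy⟩
    · intro h
      have := hp.getVert_injOn (by simp; omega) (by simp; omega) h
      omega
    · rintro rfl; exact hy (p.getVert_mem_support _)
    · rintro rfl; exact hy (p.getVert_mem_support _)
  have hsupp : ∀ y, y ∈ p.support := by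
    intro y
    obtain ⟨q⟩ := hG.connected.preconnected u y
    have : ∀ {x z : V} (q : G.Walk x z), x ∈ p.support → z ∈ p.support := by
      intro x z q
      induction q with
      | nil => exact id
      | cons h _ ih => exact fun hx => ih (hclosed _ _ h hx)
    exact this q p.start_mem_support
  have hlen : p.length + 1 = Fintype.card V := by
    rw [← (hp.isHamiltonian_iff.2 hsupp).length_support, Walk.length_support]
  have hedges : p.edges.toFinset = G.edgeFinset := by
    refine Finset.eq_of_subset_of_card_le ?_ ?_
    · intro e he
      simpa using p.edges_subset_edgeSet (by simpa using he)
    · rw [List.toFinset_card_of_nodup hp.isTrail.edges_nodup, Walk.length_edges]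
      have := hG.card_edgeFinset
      omega
  have e : p.toSubgraph.coe ≃g G :=
    { toFun := Subtype.val
      invFun := fun x => ⟨x, p.mem_verts_toSubgraph.2 (hsupp x)⟩
      left_inv := fun _ => rfl
      right_inv := fun _ => rfl
      map_rel_iff' := by
        intro a b
        change G.Adj a b ↔ p.toSubgraph.Adj a b
        rw [Walk.adj_toSubgraph_iff_mem_edges, ← List.mem_toFinset, hedges, mem_edgeFinset,
          mem_edgeSet] }
  rw [← hlen]
  exact ⟨(hp.pathGraphIsoToSubgraph.trans e).symm⟩

variable {n : ℕ}

theorem omegaComp_delVerts_pathGraph_le (X : Finset (Fin n)) :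
    ((pathGraph n).delVerts X).omegaComp ≤ X.card + 1 := by
  classical
  let H := (pathGraph n).delVerts X
  let Y : Finset ℕ := insert n (X.image Fin.val)
  have hlast : ∀ c : H.ConnectedComponent, ∃ v, H.connectedComponentMk v = c ∧
      v.1.1 + 1 ∈ Y := by
    intro c
    obtain ⟨v, hv, hmax⟩ := Set.exists_max_image {v | H.connectedComponentMk v = c}
      (fun v => v.1.1) (Set.toFinite _) c.exists_rep
    refine ⟨v, hv, ?_⟩
    by_contra hY
    simp only [Y, Finset.mem_insert, Finset.mem_image, not_or, not_exists, not_and] at hY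
    have hlt : v.1.1 + 1 < n := lt_of_le_of_ne v.1.2 hY.1
    let w : {u : Fin n // u ∉ X} := ⟨⟨v.1.1 + 1, hlt⟩, fun hw => hY.2 _ hw rfl⟩
    have hvw : H.Adj v w := pathGraph_adj.2 (Or.inl rfl)
    have := hmax w ((ConnectedComponent.sound hvw.reachable).symm.trans hv)
    simp [w] at this
  choose f hf hfY using hlast
  have hinj : Function.Injective fun c => (⟨(f c).1.1 + 1, hfY c⟩ : Y) := by
    intro c d h
    have : f c = f d := Subtype.ext (Fin.ext (by simpa using h))
    rw [← hf c, ← hf d, this]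
  have hle := Nat.card_le_card_of_injective _ hinj
  rw [Nat.card_eq_fintype_card (α := Y), Fintype.card_coe] at hle
  refine hle.trans ((Finset.card_insert_le _ _).trans ?_)
  exact Nat.add_le_add_right Finset.card_image_le 1

theorem le_tenacity_pathGraph_of_isVertexCut (hn : Even n) {X : Finset (Fin n)}
    (hX : (pathGraph n).IsVertexCut X) :
    ((n : ℝ) + 2) / n ≤ ((X.card : ℝ) + ((pathGraph n).delVerts X).tauMax) /
      ((pathGraph n).delVerts X).omegaComp := by
  have h₁ := omegaComp_delVerts_pathGraph_le X
  have h₂ := card_notMem X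
  have h₃ := ((pathGraph n).delVerts X).omegaComp_le_card
  have h₄ := ((pathGraph n).delVerts X).card_le_omegaComp_mul_tauMax
  have hω : 1 < ((pathGraph n).delVerts X).omegaComp := hX
  have : Nonempty {v // v ∉ X} := (Nat.card_pos_iff.1 (by omega)).1
  have h₅ := ((pathGraph n).delVerts X).tauMax_pos
  rw [Fintype.card_fin] at h₂
  generalize ((pathGraph n).delVerts X).omegaComp = w at *
  generalize ((pathGraph n).delVerts X).tauMax = t at *
  obtain ⟨m, rfl⟩ := hn
  have hw : 2 * w ≤ m + m := by omega
  have hwt : w + 1 ≤ X.card + t := by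
    by_cases ht : t = 1
    · subst ht; omega
    · omega
  have hm : 0 < m + m := by omega
  rw [div_le_div_iff₀ (by exact_mod_cast hm) (by exact_mod_cast (by omega : 0 < w))]
  norm_cast
  nlinarith

theorem exists_isVertexCut_pathGraph (hn : Even n) (h4 : 4 ≤ n) :
    ∃ X : Finset (Fin n), (pathGraph n).IsVertexCut X ∧
      ((n : ℝ) + 2) / n = ((X.card : ℝ) + ((pathGraph n).delVerts X).tauMax) /
        ((pathGraph n).delVerts X).omegaComp := by
  obtain ⟨m, rfl⟩ := hn
  let X : Finset (Fin (m + m)) := {v | v.1 % 2 = 1}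
  have hbot : (pathGraph (m + m)).delVerts X = ⊥ := by
    ext ⟨u, hu⟩ ⟨v, hv⟩
    simp only [X, Finset.mem_filter, Finset.mem_univ, true_and] at hu hv
    simp only [delVerts, comap_adj, pathGraph_adj, bot_adj, iff_false]
    omega
  have hXcard : X.card = m := by
    have : X = Finset.univ.image (fun i : Fin m => (⟨2 * i.1 + 1, by omega⟩ : Fin (m + m))) := by
      ext v
      simp only [X, Finset.mem_filter, Finset.mem_univ, true_and, Finset.mem_image, Fin.ext_iff]
      exact ⟨fun h => ⟨⟨v.1 / 2, by omega⟩, by dsimp only; omega⟩, fun ⟨i, hi⟩ => by omega⟩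
    rw [this, Finset.card_image_of_injective, Finset.card_univ, Fintype.card_fin]
    intro i j h
    simp only [Fin.mk.injEq] at h
    exact Fin.ext (by omega)
  have hcard := card_notMem X
  rw [Fintype.card_fin, hXcard] at hcard
  have hω : ((pathGraph (m + m)).delVerts X).omegaComp = m := by
    rw [hbot, omegaComp_bot]
    omega
  have : Nonempty {v // v ∉ X} := (Nat.card_pos_iff.1 (by omega)).1
  have hτ : ((pathGraph (m + m)).delVerts X).tauMax = 1 := by
    refine le_antisymm ?_ (tauMax_pos _)
    rw [hbot]
    exact tauMax_bot_le_one
  refine ⟨X, ?_, ?_⟩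
  · rw [IsVertexCut, hω]
    omega
  · have : (m : ℝ) ≠ 0 := by
      rw [Nat.cast_ne_zero]
      omega
    rw [hω, hτ, hXcard]
    push_cast
    field_simp
    ring

theorem tenacity_pathGraph (hn : Even n) (h4 : 4 ≤ n) :
    (pathGraph n).tenacity = ((n : ℝ) + 2) / n := by
  refine IsLeast.csInf_eq ⟨exists_isVertexCut_pathGraph hn h4, ?_⟩
  rintro _ ⟨X, hX, rfl⟩
  exact le_tenacity_pathGraph_of_isVertexCut hn hX

end Path

end SimpleGraph

theorem tree_even_not_path (n : ℕ) (hn : Even n)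
    (T : SimpleGraph (Fin n)) (hT : T.IsTree)
    (hnp : IsEmpty (T ≃g SimpleGraph.pathGraph n)) :
    T.tenacity ≤ 1 ∧ (1 : ℝ) < ((n : ℝ) + 2) / n ∧
      (SimpleGraph.pathGraph n).tenacity = ((n : ℝ) + 2) / n := by
  obtain h | ⟨v, a, b, c, hab, hac, hbc, ha, hb, hc⟩ := hT.nonempty_iso_pathGraph_or
  · rw [Fintype.card_fin] at h
    exact (not_nonempty_iff.2 hnp h).elim
  have h4 : 4 ≤ n := by
    have hcard : ({v, a, b, c} : Finset (Fin n)).card = 4 := by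
      simp [Finset.card_insert_of_notMem, ha.ne, hb.ne, hc.ne, hab, hac, hbc]
    simpa [hcard] using Finset.card_le_univ ({v, a, b, c} : Finset (Fin n))
  refine ⟨hT.tenacity_le_one hab hac hbc ha hb hc, ?_, tenacity_pathGraph hn h4⟩
  rw [one_lt_div (by exact_mod_cast (by omega : 0 < n))]
  linarith
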